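/- The double integral ∫₀^∞ ∫₀^∞ exp(−(x² + xy + y²)/(4y)) · (y^{1/6} − x^{1/6}) / (√x · y^{2/3} · log(x/y)) dx dy equals 2 log( (1 + cos(π/9)) / (4 − 4 sin(π/18)) ). -/

import Mathlib

open Real MeasureTheory

theorem tendsto_sum_cot {x : ℝ} (h0 : 0 < x) (h1 : x < 1) :
    Filter.Tendsto (fun N : ℕ => ∑ n ∈ Finset.range N, (1 / ((n : ℝ) + x) - 1 / ((n : ℝ) + 1 - x)))
      Filter.atTop (nhds (π * Real.cot (π * x))) := by
  have hx : (x : ℂ) ∈ Complex.integerComplement := by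
    rintro ⟨k, hk⟩
    have hk' : (k : ℝ) = x := by exact_mod_cast hk
    rw [← hk'] at h0 h1
    have a : 0 < k := by exact_mod_cast h0
    have b : k < 1 := by exact_mod_cast h1
    omega
  have h := Complex.continuous_re.continuousAt.tendsto.comp (tendsto_logDeriv_euler_cot_sub hx)
  have hre : ((π : ℂ) * Complex.cot (π * x) - 1 / x).re = π * Real.cot (π * x) - 1 / x := by
    have : (π : ℂ) * Complex.cot (π * x) - 1 / x = ((π * Real.cot (π * x) - 1 / x : ℝ) : ℂ) := by
      push_cast; rfl
    rw [this, Complex.ofReal_re]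
  rw [hre] at h
  have hl : Filter.Tendsto (fun N : ℕ => 1 / ((N : ℝ) + x)) Filter.atTop (nhds 0) :=
    tendsto_const_nhds.div_atTop
      (Filter.tendsto_atTop_add_const_right _ _ tendsto_natCast_atTop_atTop)
  have h2 := (h.add_const (1 / x)).sub hl
  rw [sub_zero, sub_add_cancel] at h2
  refine h2.congr fun N => ?_
  simp only [Function.comp]
  induction N with
  | zero => simp
  | succ N ih =>
    rw [Finset.sum_range_succ, Finset.sum_range_succ, ← ih]
    have : (cotTerm (x : ℂ) N) = ((1 / (x - ((N : ℝ) + 1)) + 1 / (x + ((N : ℝ) + 1)) : ℝ) : ℂ) := by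
      simp [cotTerm]
    rw [this, Complex.add_re, Complex.ofReal_re]
    have e : 1 / (x - ((N : ℝ) + 1)) = - (1 / ((N : ℝ) + 1 - x)) := by
      rw [← neg_sub, one_div, one_div, inv_neg]
    rw [e]
    push_cast
    rw [show x + ((N : ℝ) + 1) = (N : ℝ) + 1 + x by ring]
    ring

theorem hasSum_integral_rpow_div {b : ℝ} (hb : 0 < b) :
    HasSum (fun n : ℕ => 1 / (3 * (n : ℝ) + b) - 1 / (3 * (n : ℝ) + b + 1))
      (∫ t in Set.Ioo (0 : ℝ) 1, t ^ (b - 1) / (1 + t + t ^ 2)) := by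
  set F : ℕ → ℝ → ℝ := fun n t => t ^ (3 * (n : ℝ) + b - 1) - t ^ (3 * (n : ℝ) + b) with hF
  have hi : ∀ {c : ℝ}, 0 < c → IntegrableOn (fun t : ℝ => t ^ (c - 1)) (Set.Ioo 0 1) := fun hc =>
    (intervalIntegral.integrableOn_Ioo_rpow_iff one_pos).2 (by linarith)
  have hv : ∀ {c : ℝ}, 0 < c → ∫ t in Set.Ioo (0 : ℝ) 1, t ^ (c - 1) = 1 / c := by
    intro c hc
    rw [← integral_Ioc_eq_integral_Ioo, ← intervalIntegral.integral_of_le zero_le_one,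
      integral_rpow (Or.inl (by linarith))]
    simp [hc.ne']
  have hp : ∀ n : ℕ, 0 < 3 * (n : ℝ) + b := fun n => by positivity
  have hi2 : ∀ n : ℕ, IntegrableOn (fun t : ℝ => t ^ (3 * (n : ℝ) + b)) (Set.Ioo 0 1) := fun n => by
    simpa using hi (add_pos (hp n) one_pos)
  have hint : ∀ n, Integrable (F n) (volume.restrict (Set.Ioo 0 1)) := fun n =>
    (hi (hp n)).sub (hi2 n)
  have hval : ∀ n, ∫ t in Set.Ioo (0 : ℝ) 1, F n t
      = 1 / (3 * (n : ℝ) + b) - 1 / (3 * (n : ℝ) + b + 1) := fun n => by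
    have := hv (add_pos (hp n) one_pos)
    rw [add_sub_cancel_right] at this
    rw [integral_sub (hi (hp n)) (hi2 n), hv (hp n), this]
  have hFeq : ∀ n, ∀ t ∈ Set.Ioo (0 : ℝ) 1, F n t = (t ^ (b - 1) * (1 - t)) * (t ^ 3) ^ n := by
    intro n t ht
    have e1 : t ^ (3 * (n : ℝ) + b) = t ^ (3 * (n : ℝ) + b - 1) * t := by
      rw [← Real.rpow_add_one ht.1.ne', sub_add_cancel]
    have e2 : t ^ (3 * (n : ℝ) + b - 1) = t ^ (b - 1) * (t ^ 3) ^ n := by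
      rw [show 3 * (n : ℝ) + b - 1 = (b - 1) + ((3 * n : ℕ) : ℝ) by push_cast; ring,
        Real.rpow_add ht.1, Real.rpow_natCast, pow_mul]
    simp only [hF, e1, e2]; ring
  have hnn : ∀ n, ∀ t ∈ Set.Ioo (0 : ℝ) 1, 0 ≤ F n t := by
    intro n t ht
    rw [hFeq n t ht]
    have := ht.1; have := sub_pos.2 ht.2
    positivity
  have hnorm : ∀ n, ∫ t in Set.Ioo (0 : ℝ) 1, ‖F n t‖ = ∫ t in Set.Ioo (0 : ℝ) 1, F n t := fun n =>
    setIntegral_congr_fun measurableSet_Ioo fun t ht => by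
      simp only [Real.norm_of_nonneg (hnn n t ht)]
  have hsum : Summable fun n => ∫ t in Set.Ioo (0 : ℝ) 1, ‖F n t‖ := by
    simp only [hnorm, hval]
    refine (summable_nat_add_iff 1).1 ?_
    refine Summable.of_nonneg_of_le (fun n => ?_) (fun n => ?_)
      ((summable_nat_add_iff 1).2 (Real.summable_one_div_nat_pow.2 one_lt_two))
    · rw [sub_nonneg]
      exact one_div_le_one_div_of_le (hp (n + 1)) (by linarith)
    · have := hp (n + 1)
      rw [div_sub_div _ _ this.ne' (by positivity)]
      push_cast at *
      rw [div_le_div_iff₀ (by positivity) (by positivity)]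
      nlinarith [Nat.cast_nonneg (α := ℝ) n]
  have h := hasSum_integral_of_summable_integral_norm hint hsum
  simp only [hval] at h
  suffices e : ∫ t in Set.Ioo (0 : ℝ) 1, t ^ (b - 1) / (1 + t + t ^ 2)
      = ∫ t in Set.Ioo (0 : ℝ) 1, ∑' n, F n t by rwa [e]
  refine setIntegral_congr_fun measurableSet_Ioo fun t ht => ?_
  have h3 : t ^ 3 < 1 := pow_lt_one₀ ht.1.le ht.2 (by norm_num)
  rw [tsum_congr fun n => hFeq n t ht, tsum_mul_left,
    tsum_geometric_of_lt_one (pow_nonneg ht.1.le 3) h3, ← div_eq_mul_inv]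
  have := ht.1
  rw [div_eq_div_iff (by positivity) (sub_pos.2 h3).ne']
  ring

theorem integrableOn_rpow_div {a : ℝ} (h0 : 0 < a) (h2 : a < 2) :
    IntegrableOn (fun t : ℝ => t ^ (a - 1) / (1 + t + t ^ 2)) (Set.Ioi 0) := by
  have hm : ∀ s : Set ℝ, AEStronglyMeasurable (fun t : ℝ => t ^ (a - 1) / (1 + t + t ^ 2))
      (volume.restrict s) := fun s =>
    (by fun_prop : Measurable fun t : ℝ => t ^ (a - 1) / (1 + t + t ^ 2)).aestronglyMeasurable
  rw [← Set.Ioc_union_Ioi_eq_Ioi (zero_le_one (α := ℝ))]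
  refine IntegrableOn.union ?_ ?_
  · have : IntegrableOn (fun t : ℝ => t ^ (a - 1)) (Set.Ioc 0 1) := by
      rw [integrableOn_Ioc_iff_integrableOn_Ioo]
      exact (intervalIntegral.integrableOn_Ioo_rpow_iff one_pos).2 (by linarith)
    refine Integrable.mono' this (hm _) ?_
    filter_upwards [ae_restrict_mem measurableSet_Ioc] with t ht
    have := ht.1
    rw [Real.norm_of_nonneg (by positivity)]
    exact div_le_self (by positivity) (by nlinarith)
  · refine Integrable.mono' ((integrableOn_Ioi_rpow_iff (s := a - 3) one_pos).2 (by linarith))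
      (hm _) ?_
    filter_upwards [ae_restrict_mem measurableSet_Ioi] with t ht
    have h : (0 : ℝ) < t := one_pos.trans ht
    rw [Real.norm_of_nonneg (by positivity), div_le_iff₀ (by positivity),
      show a - 1 = (a - 3) + (2 : ℕ) by push_cast; ring, Real.rpow_add h, Real.rpow_natCast]
    gcongr
    linarith

theorem integral_Ioi_one_rpow_div (a : ℝ) :
    ∫ t in Set.Ioi (1 : ℝ), t ^ (a - 1) / (1 + t + t ^ 2)
      = ∫ t in Set.Ioo (0 : ℝ) 1, t ^ ((2 - a) - 1) / (1 + t + t ^ 2) := by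
  set f : ℝ → ℝ := fun t => t ^ (a - 1) / (1 + t + t ^ 2) with hf
  have h := integral_comp_rpow_Ioi ((Set.Ioi (1 : ℝ)).indicator f) (p := -1) (by norm_num)
  rw [setIntegral_indicator measurableSet_Ioi, Set.Ioi_inter_Ioi, max_eq_right zero_le_one] at h
  rw [← h, ← Set.Ioi_inter_Iio, ← setIntegral_indicator measurableSet_Iio]
  refine setIntegral_congr_fun measurableSet_Ioi fun t (ht : 0 < t) => ?_
  simp only [Set.indicator_apply, Set.mem_Ioi, Set.mem_Iio, Real.rpow_neg_one, smul_eq_mul]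
  simp only [one_lt_inv₀ ht]
  split_ifs
  · simp only [hf]
    rw [Real.inv_rpow ht.le, ← Real.rpow_neg ht.le, show -(a - 1) = (2 - a) - 1 by ring,
      show (-1 - 1 : ℝ) = -(2 : ℕ) by norm_num, Real.rpow_neg ht.le, Real.rpow_natCast]
    simp
    field_simp
    ring
  · simp

theorem integral_rpow_div {a : ℝ} (h0 : 0 < a) (h2 : a < 2) :
    ∫ t in Set.Ioi (0 : ℝ), t ^ (a - 1) / (1 + t + t ^ 2)
      = π / 3 * (Real.cot (π * (a / 3)) - Real.cot (π * ((a + 1) / 3))) := by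
  have hI := integrableOn_rpow_div h0 h2
  have hsplit := setIntegral_union (μ := volume) (Set.Ioc_disjoint_Ioi (le_refl (1 : ℝ)))
    measurableSet_Ioi
    (hI.mono_set (Set.Ioc_subset_Ioi_self)) (hI.mono_set (Set.Ioi_subset_Ioi zero_le_one))
  rw [Set.Ioc_union_Ioi_eq_Ioi (zero_le_one (α := ℝ)), integral_Ioc_eq_integral_Ioo,
    integral_Ioi_one_rpow_div] at hsplit
  rw [hsplit]
  have hs := ((hasSum_integral_rpow_div h0).add
    (hasSum_integral_rpow_div (sub_pos.2 h2))).tendsto_sum_nat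
  have ht := ((tendsto_sum_cot (x := a / 3) (by linarith) (by linarith)).sub
    (tendsto_sum_cot (x := (a + 1) / 3) (by linarith) (by linarith))).const_mul (1 / 3)
  rw [show π / 3 * (Real.cot (π * (a / 3)) - Real.cot (π * ((a + 1) / 3)))
    = 1 / 3 * (π * Real.cot (π * (a / 3)) - π * Real.cot (π * ((a + 1) / 3))) by ring]
  refine tendsto_nhds_unique hs (ht.congr fun N => ?_)
  rw [← Finset.sum_sub_distrib, Finset.mul_sum]
  refine Finset.sum_congr rfl fun n _ => ?_
  have e1 : 1 / ((n : ℝ) + a / 3) = 3 * (1 / (3 * n + a)) := by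
    rw [show (n : ℝ) + a / 3 = (3 * n + a) / 3 by ring]; simp [div_eq_mul_inv]
  have e2 : 1 / ((n : ℝ) + 1 - a / 3) = 3 * (1 / (3 * n + (2 - a) + 1)) := by
    rw [show (n : ℝ) + 1 - a / 3 = (3 * n + (2 - a) + 1) / 3 by ring]; simp [div_eq_mul_inv]
  have e3 : 1 / ((n : ℝ) + (a + 1) / 3) = 3 * (1 / (3 * n + a + 1)) := by
    rw [show (n : ℝ) + (a + 1) / 3 = (3 * n + a + 1) / 3 by ring]; simp [div_eq_mul_inv]
  have e4 : 1 / ((n : ℝ) + 1 - (a + 1) / 3) = 3 * (1 / (3 * n + (2 - a))) := by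
    rw [show (n : ℝ) + 1 - (a + 1) / 3 = (3 * n + (2 - a)) / 3 by ring]; simp [div_eq_mul_inv]
  rw [e1, e2, e3, e4]
  ring

theorem integral_rpow_exponent {w : ℝ} (h0 : 0 < w) (h1 : w ≠ 1) (p q : ℝ) :
    ∫ a in p..q, w ^ a = (w ^ q - w ^ p) / Real.log w := by
  have hl : Real.log w ≠ 0 := Real.log_ne_zero_of_pos_of_ne_one h0 h1
  simp only [Real.rpow_def_of_pos h0]
  rw [intervalIntegral.integral_comp_mul_left (fun u => Real.exp u) hl, integral_exp]
  simp [div_eq_inv_mul]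

theorem integrable_rpow_div_prod {p q : ℝ} (hp : 0 < p) (hq : q < 2) :
    Integrable (fun z : ℝ × ℝ => z.1 ^ (z.2 - 1) / (1 + z.1 + z.1 ^ 2))
      ((volume.restrict (Set.Ioi 0)).prod (volume.restrict (Set.Ioc p q))) := by
  rcases le_or_gt q p with hqp | hpq
  · simp [Set.Ioc_eq_empty_of_le hqp]
  have hb := ((integrableOn_rpow_div hp (hpq.trans hq)).add
    (integrableOn_rpow_div (hp.trans hpq) hq)).comp_fst (volume.restrict (Set.Ioc p q))
  refine Integrable.mono' hb (by fun_prop : Measurable fun z : ℝ × ℝ =>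
    z.1 ^ (z.2 - 1) / (1 + z.1 + z.1 ^ 2)).aestronglyMeasurable ?_
  rw [Measure.prod_restrict]
  filter_upwards [ae_restrict_mem (measurableSet_Ioi.prod measurableSet_Ioc)] with z hz
  have h0 : 0 < z.1 := hz.1
  have h1 := hz.2.1
  have h2 := hz.2.2
  rw [Real.norm_of_nonneg (by positivity)]
  simp only [Pi.add_apply]
  rw [← add_div]
  gcongr
  rcases le_total z.1 1 with h | h
  · have := Real.rpow_le_rpow_of_exponent_ge h0 h (by linarith : p - 1 ≤ z.2 - 1)
    have : 0 ≤ z.1 ^ (q - 1) := by positivity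
    linarith
  · have := Real.rpow_le_rpow_of_exponent_le h (by linarith : z.2 - 1 ≤ q - 1)
    have : 0 ≤ z.1 ^ (p - 1) := by positivity
    linarith

theorem integral_cot_sub_cot {p q : ℝ} (hp : 0 < p) (hpq : p ≤ q) (hq : q < 2) :
    ∫ a in p..q, π / 3 * (Real.cot (π * (a / 3)) - Real.cot (π * ((a + 1) / 3)))
      = (Real.log (Real.sin (π * (q / 3))) - Real.log (Real.sin (π * ((q + 1) / 3))))
        - (Real.log (Real.sin (π * (p / 3))) - Real.log (Real.sin (π * ((p + 1) / 3)))) := by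
  have hs : ∀ u : ℝ, 0 < u → u < 1 → Real.sin (π * u) ≠ 0 := fun u h0 h1 =>
    (Real.sin_pos_of_pos_of_lt_pi (by positivity) (by nlinarith [Real.pi_pos])).ne'
  have hs1 : ∀ a ∈ Set.uIcc p q, Real.sin (π * (a / 3)) ≠ 0 := fun a ha => by
    rw [Set.uIcc_of_le hpq] at ha
    exact hs _ (by linarith [ha.1]) (by linarith [ha.2])
  have hs2 : ∀ a ∈ Set.uIcc p q, Real.sin (π * ((a + 1) / 3)) ≠ 0 := fun a ha => by
    rw [Set.uIcc_of_le hpq] at ha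
    exact hs _ (by linarith [ha.1]) (by linarith [ha.2])
  refine intervalIntegral.integral_eq_sub_of_hasDerivAt
    (f := fun a => Real.log (Real.sin (π * (a / 3))) - Real.log (Real.sin (π * ((a + 1) / 3))))
    (fun a ha => ?_) (ContinuousOn.intervalIntegrable ?_)
  · have d1 : HasDerivAt (fun a : ℝ => π * (a / 3)) (π * (1 / 3)) a :=
      ((hasDerivAt_id a).div_const 3).const_mul π
    have d2 : HasDerivAt (fun a : ℝ => π * ((a + 1) / 3)) (π * (1 / 3)) a :=
      (((hasDerivAt_id a).add_const 1).div_const 3).const_mul π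
    refine ((d1.sin.log (hs1 a ha)).sub (d2.sin.log (hs2 a ha))).congr_deriv ?_
    rw [Real.cot_eq_cos_div_sin, Real.cot_eq_cos_div_sin]
    ring
  · simp only [Real.cot_eq_cos_div_sin]
    exact continuousOn_const.mul (((by fun_prop : Continuous fun a : ℝ =>
      Real.cos (π * (a / 3))).continuousOn.div (by fun_prop) hs1).sub
      ((by fun_prop : Continuous fun a : ℝ =>
      Real.cos (π * ((a + 1) / 3))).continuousOn.div (by fun_prop) hs2))

theorem integral_exp_neg_mul_Ioi_zero {c : ℝ} (hc : 0 < c) :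
    ∫ x in Set.Ioi (0 : ℝ), Real.exp (-c * x) = 1 / c := by
  rw [integral_exp_mul_Ioi (neg_lt_zero.2 hc)]
  simp

theorem integrand_scale {x w : ℝ} (hx : 0 < x) (hw : 0 < w) :
    x * (Real.exp (-(x ^ 2 + x * (x * w) + (x * w) ^ 2) / (4 * (x * w))) *
        ((x * w) ^ ((1 : ℝ) / 6) - x ^ ((1 : ℝ) / 6)) /
        (Real.sqrt x * (x * w) ^ ((2 : ℝ) / 3) * Real.log (x / (x * w))))
      = Real.exp (-((1 + w + w⁻¹) / 4) * x) *
        -((w ^ ((1 : ℝ) / 6) - 1) / (w ^ ((2 : ℝ) / 3) * Real.log w)) := by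
  have e1 : -(x ^ 2 + x * (x * w) + (x * w) ^ 2) / (4 * (x * w)) = -((1 + w + w⁻¹) / 4) * x := by
    field_simp; ring
  have e2 : Real.log (x / (x * w)) = -Real.log w := by
    rw [← Real.log_inv]; congr 1; field_simp
  have e3 : Real.sqrt x * x ^ ((2 : ℝ) / 3) = x * x ^ ((1 : ℝ) / 6) := by
    rw [Real.sqrt_eq_rpow, ← Real.rpow_add hx, mul_comm x, ← Real.rpow_add_one hx.ne']
    norm_num
  have e4 : Real.sqrt x * (x * w) ^ ((2 : ℝ) / 3) * Real.log (x / (x * w))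
      = (x * x ^ ((1 : ℝ) / 6)) * -(w ^ ((2 : ℝ) / 3) * Real.log w) := by
    rw [e2, Real.mul_rpow hx.le hw.le, ← e3]; ring
  rw [e4, e1, Real.mul_rpow hx.le hw.le]
  have : x ^ ((1 : ℝ) / 6) ≠ 0 := (Real.rpow_pos_of_pos hx _).ne'
  rw [show x ^ ((1 : ℝ) / 6) * w ^ ((1 : ℝ) / 6) - x ^ ((1 : ℝ) / 6)
    = x ^ ((1 : ℝ) / 6) * (w ^ ((1 : ℝ) / 6) - 1) by ring]
  generalize x ^ ((1 : ℝ) / 6) = c at *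
  rw [show ∀ E d m : ℝ, x * (E * (c * d) / (x * c * -m)) = (x * c) * (E * d) / ((x * c) * -m) by
    intros; ring, mul_div_mul_left _ _ (mul_ne_zero hx.ne' this), div_neg]
  ring

theorem neg_div_log_eq_integral {w : ℝ} (h0 : 0 < w) (h1 : w ≠ 1) :
    4 / (1 + w + w⁻¹) * ((w ^ ((1 : ℝ) / 6) - 1) / (w ^ ((2 : ℝ) / 3) * Real.log w))
      = 4 * ∫ a in Set.Ioc (4 / 3 : ℝ) (3 / 2), w ^ (a - 1) / (1 + w + w ^ 2) := by
  rw [← intervalIntegral.integral_of_le (by norm_num), intervalIntegral.integral_div,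
    intervalIntegral.integral_comp_sub_right (fun a => w ^ a), integral_rpow_exponent h0 h1]
  have e1 : w ^ ((3 : ℝ) / 2 - 1) = w ^ ((1 : ℝ) / 3) * w ^ ((1 : ℝ) / 6) := by
    rw [← Real.rpow_add h0]; norm_num
  have e2 : w ^ ((4 : ℝ) / 3 - 1) = w ^ ((1 : ℝ) / 3) := by norm_num
  have e3 : w ^ ((1 : ℝ) / 3) * w ^ ((2 : ℝ) / 3) = w := by
    rw [← Real.rpow_add h0]; norm_num
  have hc : 0 < w ^ ((2 : ℝ) / 3) := by positivity
  rw [e1, e2, eq_div_of_mul_eq hc.ne' e3]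
  have hl : Real.log w ≠ 0 := Real.log_ne_zero_of_pos_of_ne_one h0 h1
  field_simp
  ring

theorem log_sin_combination :
    -4 * ((Real.log (Real.sin (π * ((3 / 2) / 3))) - Real.log (Real.sin (π * ((3 / 2 + 1) / 3))))
        - (Real.log (Real.sin (π * ((4 / 3) / 3))) - Real.log (Real.sin (π * ((4 / 3 + 1) / 3)))))
      = 2 * Real.log ((1 + Real.cos (π / 9)) / (4 - 4 * Real.sin (π / 18))) := by
  have e1 : Real.sin (π * ((3 / 2) / 3)) = 1 := by
    rw [show π * ((3 / 2) / 3) = π / 2 by ring, Real.sin_pi_div_two]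
  have e2 : Real.sin (π * ((3 / 2 + 1) / 3)) = 1 / 2 := by
    rw [show π * ((3 / 2 + 1) / 3) = π - π / 6 by ring, Real.sin_pi_sub, Real.sin_pi_div_six]
  have e3 : Real.sin (π * ((4 / 3) / 3)) = Real.cos (π / 18) := by
    rw [show π * ((4 / 3) / 3) = π / 2 - π / 18 by ring, Real.sin_pi_div_two_sub]
  have e4 : Real.sin (π * ((4 / 3 + 1) / 3)) = Real.sin (2 * π / 9) := by
    rw [show π * ((4 / 3 + 1) / 3) = π - 2 * π / 9 by ring, Real.sin_pi_sub]
  have e5 : 1 + Real.cos (π / 9) = 2 * Real.cos (π / 18) ^ 2 := by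
    rw [show π / 9 = 2 * (π / 18) by ring, Real.cos_two_mul]; ring
  have e6 : Real.sin (π / 18) = 1 - 2 * Real.sin (2 * π / 9) ^ 2 := by
    rw [← Real.cos_pi_div_two_sub, show π / 2 - π / 18 = 2 * (2 * π / 9) by ring,
      Real.cos_two_mul, Real.cos_sq']; ring
  have p1 : 0 < Real.cos (π / 18) :=
    Real.cos_pos_of_mem_Ioo ⟨by linarith [Real.pi_pos], by linarith [Real.pi_pos]⟩
  have p2 : 0 < Real.sin (2 * π / 9) :=
    Real.sin_pos_of_pos_of_lt_pi (by positivity) (by linarith [Real.pi_pos])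
  rw [e1, e2, e3, e4, e5, e6, show 2 * Real.cos (π / 18) ^ 2
    / (4 - 4 * (1 - 2 * Real.sin (2 * π / 9) ^ 2))
    = (Real.cos (π / 18) / (2 * Real.sin (2 * π / 9))) ^ 2 by field_simp; ring,
    Real.log_pow, Real.log_div p1.ne' (by positivity), Real.log_mul two_ne_zero p2.ne',
    one_div, Real.log_inv, Real.log_one]
  push_cast
  ring

theorem stmt5 :
    (∫ x in Set.Ioi (0:ℝ), ∫ y in Set.Ioi (0:ℝ),
      Real.exp (-(x^2 + x*y + y^2) / (4*y)) *
        (y ^ ((1:ℝ)/6) - x ^ ((1:ℝ)/6)) /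
        (Real.sqrt x * y ^ ((2:ℝ)/3) * Real.log (x/y)))
    = 2 * Real.log ((1 + Real.cos (π/9)) / (4 - 4 * Real.sin (π/18))) := by
  set g : ℝ → ℝ := fun w => (w ^ ((1 : ℝ) / 6) - 1) / (w ^ ((2 : ℝ) / 3) * Real.log w) with hg
  set P : ℝ → ℝ → ℝ := fun w a => w ^ (a - 1) / (1 + w + w ^ 2) with hP
  have hPint : Integrable (Function.uncurry P)
      ((volume.restrict (Set.Ioi 0)).prod (volume.restrict (Set.Ioc (4 / 3 : ℝ) (3 / 2)))) :=
    integrable_rpow_div_prod (by norm_num) (by norm_num)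
  have hscale : ∀ x ∈ Set.Ioi (0 : ℝ), (∫ y in Set.Ioi (0:ℝ),
      Real.exp (-(x^2 + x*y + y^2) / (4*y)) *
        (y ^ ((1:ℝ)/6) - x ^ ((1:ℝ)/6)) /
        (Real.sqrt x * y ^ ((2:ℝ)/3) * Real.log (x/y)))
      = ∫ w in Set.Ioi (0 : ℝ), Real.exp (-((1 + w + w⁻¹) / 4) * x) * -g w := by
    intro x (hx : 0 < x)
    have h := integral_comp_mul_left_Ioi (fun y => Real.exp (-(x^2 + x*y + y^2) / (4*y)) *
        (y ^ ((1:ℝ)/6) - x ^ ((1:ℝ)/6)) /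
        (Real.sqrt x * y ^ ((2:ℝ)/3) * Real.log (x/y))) 0 hx
    rw [mul_zero, smul_eq_mul, ← div_eq_inv_mul, eq_div_iff hx.ne', mul_comm] at h
    rw [← h, ← integral_const_mul]
    exact setIntegral_congr_fun measurableSet_Ioi fun w hw => integrand_scale hx hw
  have hc : ∀ w : ℝ, 0 < w → 0 < (1 + w + w⁻¹) / 4 := fun w hw => by positivity
  have hae : ∀ᵐ w ∂(volume.restrict (Set.Ioi (0 : ℝ))),
      4 / (1 + w + w⁻¹) * g w = 4 * ∫ a in Set.Ioc (4 / 3 : ℝ) (3 / 2), P w a := by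
    filter_upwards [ae_restrict_mem measurableSet_Ioi,
      ae_restrict_of_ae (Measure.ae_ne volume (1 : ℝ))] with w hw h1
    exact neg_div_log_eq_integral hw h1
  have hgnn : ∀ᵐ w ∂(volume.restrict (Set.Ioi (0 : ℝ))), 0 ≤ g w := by
    filter_upwards [ae_restrict_mem measurableSet_Ioi, hae] with w (hw : 0 < w) h
    have hr : 0 ≤ 4 * ∫ a in Set.Ioc (4 / 3 : ℝ) (3 / 2), P w a :=
      mul_nonneg (by norm_num) (integral_nonneg fun a => by positivity)
    rw [← h] at hr
    exact nonneg_of_mul_nonneg_right hr (by positivity)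
  have hH : Integrable (Function.uncurry fun x w : ℝ =>
      Real.exp (-((1 + w + w⁻¹) / 4) * x) * -g w)
      ((volume.restrict (Set.Ioi 0)).prod (volume.restrict (Set.Ioi 0))) := by
    rw [integrable_prod_iff']
    · constructor
      · filter_upwards [ae_restrict_mem measurableSet_Ioi] with w hw
        exact (integrableOn_exp_mul_Ioi (neg_lt_zero.2 (hc w hw)) 0).mul_const (-g w)
      · refine (hPint.integral_prod_left.const_mul 4).congr ?_
        filter_upwards [ae_restrict_mem measurableSet_Ioi, hae, hgnn] with w hw h hn
        simp only [Function.uncurry, norm_mul, norm_neg, Real.norm_of_nonneg hn,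
          Real.norm_of_nonneg (Real.exp_pos _).le]
        rw [integral_mul_const, integral_exp_neg_mul_Ioi_zero (hc w hw), one_div_div, h]
    · refine Measurable.aestronglyMeasurable ?_
      simp only [Function.uncurry_def, hg]
      fun_prop
  rw [setIntegral_congr_fun measurableSet_Ioi hscale, integral_integral_swap hH]
  have hinner : ∫ w in Set.Ioi (0 : ℝ), ∫ x in Set.Ioi (0 : ℝ),
      Real.exp (-((1 + w + w⁻¹) / 4) * x) * -g w
      = ∫ w in Set.Ioi (0 : ℝ), -4 * ∫ a in Set.Ioc (4 / 3 : ℝ) (3 / 2), P w a := by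
    refine integral_congr_ae ?_
    filter_upwards [ae_restrict_mem measurableSet_Ioi, hae] with w hw h
    rw [integral_mul_const, integral_exp_neg_mul_Ioi_zero (hc w hw), one_div_div, mul_neg, h,
      neg_mul]
  rw [hinner, integral_const_mul, integral_integral_swap hPint, ← log_sin_combination,
    ← integral_cot_sub_cot (by norm_num) (by norm_num) (by norm_num),
    intervalIntegral.integral_of_le (by norm_num)]
  congr 1
  exact setIntegral_congr_fun measurableSet_Ioc fun a ha =>
    integral_rpow_div (by linarith [ha.1]) (by linarith [ha.2])
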